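/- Let T ≥ 1 be a natural number, L₁ > 0, σ² ≥ 0, δ² ≥ 0, E ≥ 1 a natural number, ε > δ², Δ > 0, and 0 < η < 2(ε − δ²)/(L₁(ε + E σ²)). Let a₀, …, a_T and S₀, …, S_{T−1} be real numbers with Sₜ ≥ 0, a_{t+1} ≤ aₜ + (L₁η²/2 − η)·Sₜ + (L₁ E η² σ²)/2 + η δ² for each t < T, and a₀ − a_T ≤ Δ. If moreover T > Δ/(ε(η − L₁η²/2) − (L₁ E η² σ²)/2 − η δ²), then (1/T) Σ_{t=0}^{T−1} Sₜ ≤ (Δ/T + (L₁ E η² σ²)/2 + η δ²)/(η − L₁η²/2) < ε. -/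

import Mathlib

/-- A sequence with per-step descent `a (t + 1) ≤ a t - c * S t + K` satisfies the telescoped
bound `c * ∑ S t ≤ a 0 - a T + T * K`. -/
theorem mul_sum_range_le_of_descent {a S : ℕ → ℝ} {c K : ℝ} {T : ℕ}
    (h : ∀ t < T, a (t + 1) ≤ a t - c * S t + K) :
    c * ∑ t ∈ Finset.range T, S t ≤ a 0 - a T + T * K := by
  calc c * ∑ t ∈ Finset.range T, S t
      = ∑ t ∈ Finset.range T, c * S t := Finset.mul_sum ..
    _ ≤ ∑ t ∈ Finset.range T, (a t - a (t + 1) + K) :=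
        Finset.sum_le_sum fun t ht => by linarith [h t (Finset.mem_range.mp ht)]
    _ = a 0 - a T + T * K := by
        rw [Finset.sum_add_distrib, Finset.sum_range_sub']
        simp

/-- Theorem 5.4 (Non-convex Convergence Rate of pFedMoE): under the per-round bound of
Theorem 5.3 with learning rate `η < 2(ε − δ²)/(L₁(ε + Eσ²))` and `T` large enough, the
average sum of expected squared gradient norms over `T` rounds falls below `ε`. -/
theorem pFedMoE_nonconvex_convergence
    (T : ℕ) (hT : 1 ≤ T) (L₁ σ2 δ2 : ℝ) (hL₁ : 0 < L₁) (hσ2 : 0 ≤ σ2) (hδ2 : 0 ≤ δ2)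
    (E : ℕ) (hE : 1 ≤ E) (ε Δ : ℝ) (hε : δ2 < ε) (hΔ : 0 < Δ)
    (η : ℝ) (hη0 : 0 < η) (hη : η < 2 * (ε - δ2) / (L₁ * (ε + E * σ2)))
    (a : ℕ → ℝ) (S : ℕ → ℝ) (hS : ∀ t, 0 ≤ S t)
    (hround : ∀ t < T,
      a (t + 1) ≤ a t + (L₁ * η ^ 2 / 2 - η) * S t + L₁ * E * η ^ 2 * σ2 / 2 + η * δ2)
    (htel : a 0 - a T ≤ Δ)
    (hT' : (T : ℝ) >
      Δ / (ε * (η - L₁ * η ^ 2 / 2) - L₁ * E * η ^ 2 * σ2 / 2 - η * δ2)) :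
    (1 / T : ℝ) * ∑ t ∈ Finset.range T, S t ≤
        (Δ / T + L₁ * E * η ^ 2 * σ2 / 2 + η * δ2) / (η - L₁ * η ^ 2 / 2) ∧
      (Δ / T + L₁ * E * η ^ 2 * σ2 / 2 + η * δ2) / (η - L₁ * η ^ 2 / 2) < ε := by
  have hT0 : (0 : ℝ) < T := by exact_mod_cast hT
  have hε0 : 0 < ε := hδ2.trans_lt hε
  have hEσ : 0 ≤ (E : ℝ) * σ2 := by positivity
  have hgap : 0 < ε * (η - L₁ * η ^ 2 / 2) - L₁ * E * η ^ 2 * σ2 / 2 - η * δ2 := by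
    rw [lt_div_iff₀ (by positivity)] at hη
    linear_combination (η / 2) * hη
  have hc : 0 < η - L₁ * η ^ 2 / 2 := by
    have hnoise : 0 ≤ L₁ * E * η ^ 2 * σ2 / 2 + η * δ2 := by positivity
    exact pos_of_mul_pos_right (by linarith) hε0.le
  constructor
  · have hsum := mul_sum_range_le_of_descent (a := a) (S := S) (T := T)
      (c := η - L₁ * η ^ 2 / 2) (K := L₁ * E * η ^ 2 * σ2 / 2 + η * δ2)
      fun t ht => by linarith [hround t ht]
    rw [le_div_iff₀ hc, add_assoc, div_add' _ _ _ hT0.ne', le_div_iff₀ hT0]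
    calc 1 / (T : ℝ) * (∑ t ∈ Finset.range T, S t) * (η - L₁ * η ^ 2 / 2) * T
        = (η - L₁ * η ^ 2 / 2) * ∑ t ∈ Finset.range T, S t := by field_simp
      _ ≤ Δ + (L₁ * E * η ^ 2 * σ2 / 2 + η * δ2) * T := by linarith
  · have hΔT := (div_lt_comm₀ hgap hT0).mp hT'
    rw [div_lt_iff₀ hc]
    linarith
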